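/- arXiv:2205.13094 — 4 statements merged into one kernel-verified Lean document; each statement's English description precedes it below -/
import Mathlib

section
/- Let (P_maj, P_min) ∈ P_GS(τ) for some τ ∈ [0,1] and let A_USB be the undersampled binning estimator with K bins. Then its expected excess risk satisfies ExcessRisk[A_USB; (P_maj, P_min)] ≤ Σ_{j=1}^{K} E_{S ~ P_maj^{n_maj} × P_min^{n_min}}[ R_j(A_USB^S) ] · P_test(I_j) + 2/K, where P_test(I_j) = ∫_{I_j} P_test(x) dx. -/
open MeasureTheory Set
open scoped ENNReal Classical

noncomputable section

/-! ## Basic setup: distributions on `ℝ × Bool`, risk, excess risk.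

A labelled example is a pair `(x, y) : ℝ × Bool`, where the label `true` codes `+1`
and `false` codes `-1`; features are supported on `[0,1]`. -/

/-- The risk (probability of misclassification) of a classifier `f : ℝ → Bool`
under a distribution `P` on `ℝ × Bool`. -/
def risk (f : ℝ → Bool) (P : Measure (ℝ × Bool)) : ℝ :=
  (P {p : ℝ × Bool | f p.1 ≠ p.2}).toReal

/-- The Bayes risk of a distribution: the infimum of the risk over all classifiers. -/
def bayesRisk (P : Measure (ℝ × Bool)) : ℝ :=
  ⨅ f : ℝ → Bool, risk f P

/-- The balanced test distribution `P_test = (1/2) P_maj + (1/2) P_min`. -/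
def testMeasure (Pmaj Pmin : Measure (ℝ × Bool)) : Measure (ℝ × Bool) :=
  (2 : ℝ≥0∞)⁻¹ • Pmaj + (2 : ℝ≥0∞)⁻¹ • Pmin

/-- A training sample: `nmaj` labelled points from the majority distribution and
`nmin` labelled points from the minority distribution. -/
abbrev Sample (nmaj nmin : ℕ) : Type :=
  (Fin nmaj → ℝ × Bool) × (Fin nmin → ℝ × Bool)

/-- The law `P_maj^{n_maj} × P_min^{n_min}` of the training sample. -/
def sampleMeasure (nmaj nmin : ℕ) (Pmaj Pmin : Measure (ℝ × Bool)) :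
    Measure (Sample nmaj nmin) :=
  (Measure.pi fun _ : Fin nmaj => Pmaj).prod (Measure.pi fun _ : Fin nmin => Pmin)

/-- An algorithm (a map from samples to classifiers) is measurable if the joint map
`(S, x) ↦ A S x` is measurable. -/
def MeasurableAlg (nmaj nmin : ℕ) (A : Sample nmaj nmin → ℝ → Bool) : Prop :=
  Measurable fun p : Sample nmaj nmin × ℝ => A p.1 p.2

/-- The expected excess risk of the algorithm `A` on the pair `(P_maj, P_min)`:
`E_{S ~ P_maj^{n_maj} × P_min^{n_min}}[R(A^S; P_test)] - R(f^*; P_test)`. -/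
def excessRisk (nmaj nmin : ℕ) (A : Sample nmaj nmin → ℝ → Bool)
    (Pmaj Pmin : Measure (ℝ × Bool)) : ℝ :=
  (∫ S, risk (A S) (testMeasure Pmaj Pmin) ∂sampleMeasure nmaj nmin Pmaj Pmin)
    - bayesRisk (testMeasure Pmaj Pmin)

/-- The distribution on `ℝ × Bool` supported on label `y` whose feature has density `p`
(w.r.t. Lebesgue measure) on `[0,1]`. -/
def labelMeasure (p : ℝ → ℝ) (y : Bool) : Measure (ℝ × Bool) :=
  Measure.map (fun x => (x, y))
    ((volume.restrict (Icc (0:ℝ) 1)).withDensity fun x => ENNReal.ofReal (p x))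

/-- The label-shift class `𝒫_LS`: `P_maj(x,y) = P₁(x)·1{y = 1}`,
`P_min(x,y) = P₋₁(x)·1{y = -1}` with `P₁, P₋₁` 1-Lipschitz densities on `[0,1]`. -/
def memLS (Pmaj Pmin : Measure (ℝ × Bool)) : Prop :=
  ∃ p1 pm1 : ℝ → ℝ,
    (∀ x, 0 ≤ p1 x) ∧ (∀ x, 0 ≤ pm1 x) ∧
    LipschitzOnWith 1 p1 (Icc 0 1) ∧ LipschitzOnWith 1 pm1 (Icc 0 1) ∧
    (∫ x in Icc (0:ℝ) 1, p1 x) = 1 ∧ (∫ x in Icc (0:ℝ) 1, pm1 x) = 1 ∧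
    Pmaj = labelMeasure p1 true ∧ Pmin = labelMeasure pm1 false

/-- Total variation distance between two densities on `[0,1]`:
`TV(p, q) = (1/2)∫₀¹ |p - q|`. -/
def tvDist (p q : ℝ → ℝ) : ℝ :=
  (1/2) * ∫ x in Icc (0:ℝ) 1, |p x - q x|

/-- The distribution on `ℝ × Bool` whose feature has density `p` on `[0,1]` and whose
label is `true` with probability `η x` conditionally on the feature `x`. -/
def covMeasure (p η : ℝ → ℝ) : Measure (ℝ × Bool) :=
  labelMeasure (fun x => p x * η x) true + labelMeasure (fun x => p x * (1 - η x)) false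

/-- The group-covariate shift class `𝒫_GS(τ)`: `P_maj(x,y) = P_a(x)·P(y|x)`,
`P_min(x,y) = P_b(x)·P(y|x)` with group densities `P_a, P_b` on `[0,1]`,
a shared 1-Lipschitz conditional label distribution, and overlap
`1 - TV(P_a, P_b) ≥ τ`. -/
def memGS (τ : ℝ) (Pmaj Pmin : Measure (ℝ × Bool)) : Prop :=
  ∃ pa pb η : ℝ → ℝ,
    (∀ x, 0 ≤ pa x) ∧ (∀ x, 0 ≤ pb x) ∧
    (∫ x in Icc (0:ℝ) 1, pa x) = 1 ∧ (∫ x in Icc (0:ℝ) 1, pb x) = 1 ∧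
    (∀ x, 0 ≤ η x ∧ η x ≤ 1) ∧
    LipschitzOnWith 1 η (Icc 0 1) ∧ LipschitzOnWith 1 (fun x => 1 - η x) (Icc 0 1) ∧
    τ ≤ 1 - tvDist pa pb ∧
    Pmaj = covMeasure pa η ∧ Pmin = covMeasure pb η

/-! ## The hat function -/

/-- The hat function `φ_K`. -/
def hatFun (K : ℕ) (x : ℝ) : ℝ :=
  if x ∈ Icc (-(1/(2*(K:ℝ)))) 0 then |x + 1/(4*(K:ℝ))| - 1/(4*(K:ℝ))
  else if x ∈ Icc (0:ℝ) (1/(2*(K:ℝ))) then 1/(4*(K:ℝ)) - |x - 1/(4*(K:ℝ))|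
  else 0

/-! ## The hard family for the label-shift lower bound.

Bins are 0-indexed: `I_j = [j/K, (j+1)/K)` for `j = 0, …, K-1`, corresponding to the
paper's `I_{j+1} = [((j+1)-1)/K, (j+1)/K]`; the bin center is `(j + 1/2)/K`. -/

/-- The value in `{-1, 0, 1}` coded by an element of `Fin 3`. -/
def trit (i : Fin 3) : ℝ := (i : ℝ) - 1

/-- The perturbed density of the hard label-shift family: on the bin
`I_j = [j/K, (j+1)/K)` it equals `1 + v_j · φ_K(x - (j + 1/2)/K)`. -/
def hardDensityLS (K : ℕ) (v : Fin K → Fin 3) (x : ℝ) : ℝ :=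
  1 + ∑ j : Fin K,
    (if x ∈ Ico ((j:ℝ)/(K:ℝ)) (((j:ℝ)+1)/(K:ℝ))
      then trit (v j) * hatFun K (x - ((j:ℝ) + 1/2)/(K:ℝ)) else 0)

/-- The index set `𝒱 = {-1,0,1}^K × {-1,0,1}^K` of the hard label-shift family. -/
abbrev TritPair (K : ℕ) : Type := (Fin K → Fin 3) × (Fin K → Fin 3)

/-- The law `Q(S | v) = P_{v,maj}^{n_maj} × P_{v,min}^{n_min}` of the sample for the hard
label-shift instance indexed by `v`. -/
def hardLSMeasure (K nmaj nmin : ℕ) (v : TritPair K) : Measure (Sample nmaj nmin) :=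
  sampleMeasure nmaj nmin (labelMeasure (hardDensityLS K v.1) true)
    (labelMeasure (hardDensityLS K v.2) false)

/-- The marginal law `Q_S` of the sample when the index `V` is uniform on `𝒱`. -/
def hardLSMarginal (K nmaj nmin : ℕ) : Measure (Sample nmaj nmin) :=
  ∑ v : TritPair K, (Fintype.card (TritPair K) : ℝ≥0∞)⁻¹ • hardLSMeasure K nmaj nmin v

/-- The posterior weight `Q(v | S)`: the Radon–Nikodym derivative of
`(1/|𝒱|) · Q(S | v)` with respect to `Q_S`, evaluated at `S`. -/
def postLS (K nmaj nmin : ℕ) (v : TritPair K) (S : Sample nmaj nmin) : ℝ :=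
  (((Fintype.card (TritPair K) : ℝ≥0∞)⁻¹ • hardLSMeasure K nmaj nmin v).rnDeriv
      (hardLSMarginal K nmaj nmin) S).toReal

/-- The posterior mixture density `Σ_{v ∈ 𝒱} Q(v | S) · P_{v, ±1}`;
`cls = true` selects the class `+1` densities `P_{v,1}`. -/
def postMixLS (K nmaj nmin : ℕ) (S : Sample nmaj nmin) (cls : Bool) (x : ℝ) : ℝ :=
  ∑ v : TritPair K,
    postLS K nmaj nmin v S * hardDensityLS K (if cls then v.1 else v.2) x

/-! ## The hard family for the group-covariate shift lower bound -/

/-- The sign `+1` / `-1` coded by a Bool. -/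
def sgnB (b : Bool) : ℝ := if b then 1 else -1

/-- `P_v(y = 1 | x)` for the hard group-shift family: on the bin `I_j = [j/K, (j+1)/K)` it
equals `(1/2)(1 + v_j · φ_K(x - (j+1/2)/K))`. -/
def hardEta (K : ℕ) (v : Fin K → Bool) (x : ℝ) : ℝ :=
  (1/2) * (1 + ∑ j : Fin K,
    (if x ∈ Ico ((j:ℝ)/(K:ℝ)) (((j:ℝ)+1)/(K:ℝ))
      then sgnB (v j) * hatFun K (x - ((j:ℝ) + 1/2)/(K:ℝ)) else 0))

/-- The majority-group feature density: `2 - τ` on `[0, 1/2)` and `τ` on `[1/2, 1]`. -/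
def hardPa (τ : ℝ) (x : ℝ) : ℝ := if x < 1/2 then 2 - τ else τ

/-- The minority-group feature density `P_b = 2 - P_a`. -/
def hardPb (τ : ℝ) (x : ℝ) : ℝ := 2 - hardPa τ x

/-- The law `Q(S | v)` of the sample for the hard group-shift instance indexed by `v`. -/
def hardGSMeasure (K nmaj nmin : ℕ) (τ : ℝ) (v : Fin K → Bool) :
    Measure (Sample nmaj nmin) :=
  sampleMeasure nmaj nmin (covMeasure (hardPa τ) (hardEta K v))
    (covMeasure (hardPb τ) (hardEta K v))

/-- The conditional law `Q(S | v_j = b)` of the sample given the `j`-th coordinate of the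
uniformly random index: the uniform mixture over all `v` with `v_j = b`. -/
def condGS (K nmaj nmin : ℕ) (τ : ℝ) (j : Fin K) (b : Bool) :
    Measure (Sample nmaj nmin) :=
  ((Finset.univ.filter fun v : Fin K → Bool => v j = b).card : ℝ≥0∞)⁻¹ •
    ∑ v ∈ Finset.univ.filter (fun v : Fin K → Bool => v j = b),
      hardGSMeasure K nmaj nmin τ v

/-- The Kullback–Leibler divergence `KL(μ ‖ ν) = ∫ log (dμ/dν) dμ`. -/
def klDiv' {α : Type*} [MeasurableSpace α] (μ ν : Measure α) : ℝ :=
  ∫ x, Real.log ((μ.rnDeriv ν x).toReal) ∂μ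

/-! ## The undersampled binning estimator -/

/-- The prediction of the undersampled binning estimator on the bin `I_j = [j/K, (j+1)/K)`
(0-indexed), where `s ⊆ Fin nmaj` is the set of retained majority samples: predict `+1`
iff the samples of the undersampled dataset in the bin with label `+1` strictly
outnumber those with label `-1`. -/
def usbBinPred (nmaj nmin K : ℕ) (s : Finset (Fin nmaj)) (S : Sample nmaj nmin)
    (j : ℕ) : Bool :=
  decide
    ((s.filter fun i => (S.1 i).2 = false ∧
        (S.1 i).1 ∈ Ico ((j:ℝ)/(K:ℝ)) (((j:ℝ)+1)/(K:ℝ))).card +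
      (Finset.univ.filter fun i : Fin nmin => (S.2 i).2 = false ∧
        (S.2 i).1 ∈ Ico ((j:ℝ)/(K:ℝ)) (((j:ℝ)+1)/(K:ℝ))).card
      <
      (s.filter fun i => (S.1 i).2 = true ∧
        (S.1 i).1 ∈ Ico ((j:ℝ)/(K:ℝ)) (((j:ℝ)+1)/(K:ℝ))).card +
      (Finset.univ.filter fun i : Fin nmin => (S.2 i).2 = true ∧
        (S.2 i).1 ∈ Ico ((j:ℝ)/(K:ℝ)) (((j:ℝ)+1)/(K:ℝ))).card)

/-- The undersampled binning classifier `A_USB^{S,K}` with `K` bins, given the retained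
majority samples `s`: on each bin it predicts the majority label among the undersampled
data in that bin. -/
def usbClassifier (nmaj nmin K : ℕ) (s : Finset (Fin nmaj)) (S : Sample nmaj nmin) :
    ℝ → Bool :=
  fun x => usbBinPred nmaj nmin K s S (min ⌊x * (K:ℝ)⌋₊ (K - 1))

/-- The expected excess risk of the undersampled binning estimator with `K` bins, where the
`nmin` retained majority samples are drawn uniformly at random without replacement
(uniformly among all subsets of size `nmin`). -/
def usbExcessRisk (nmaj nmin K : ℕ) (Pmaj Pmin : Measure (ℝ × Bool)) : ℝ :=
  (∑ s ∈ Finset.powersetCard nmin (Finset.univ : Finset (Fin nmaj)),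
      ∫ S, risk (usbClassifier nmaj nmin K s S) (testMeasure Pmaj Pmin)
        ∂sampleMeasure nmaj nmin Pmaj Pmin)
    / ((Finset.powersetCard nmin (Finset.univ : Finset (Fin nmaj))).card : ℝ)
  - bayesRisk (testMeasure Pmaj Pmin)

/-- `q_{j,y} = P(y | x ∈ I_j)` for the 0-indexed bin `I_j = [j/K, (j+1)/K)`. -/
def qBin (P : Measure (ℝ × Bool)) (K j : ℕ) (y : Bool) : ℝ :=
  (P ((Ico ((j:ℝ)/(K:ℝ)) (((j:ℝ)+1)/(K:ℝ))) ×ˢ ({y} : Set Bool))).toReal /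
    (P ((Ico ((j:ℝ)/(K:ℝ)) (((j:ℝ)+1)/(K:ℝ))) ×ˢ (univ : Set Bool))).toReal

/-- The excess risk of the binning estimator in the bin `I_j`:
`R_j(A_USB^S) = q_{j, -A_j^S} - min{q_{j,1}, q_{j,-1}}`. -/
def binExcess (nmaj nmin K : ℕ) (s : Finset (Fin nmaj)) (S : Sample nmaj nmin)
    (P : Measure (ℝ × Bool)) (j : ℕ) : ℝ :=
  qBin P K j (!(usbBinPred nmaj nmin K s S j)) - min (qBin P K j true) (qBin P K j false)

/-- The binomial probability mass function `P[Bin(m, p) = k]`. -/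
def binomPMF (m : ℕ) (p : ℝ) (k : ℕ) : ℝ :=
  (m.choose k : ℝ) * p ^ k * (1 - p) ^ (m - k)

/-- The joint law of `(x, y)` when `x ∼ μ` and `y = true` with conditional probability `η x`. -/
def regMeasure (μ : Measure ℝ) (η : ℝ → ℝ) : Measure (ℝ × Bool) :=
  (μ.withDensity fun x => ENNReal.ofReal (η x)).map (fun x => (x, true)) +
    (μ.withDensity fun x => ENNReal.ofReal (1 - η x)).map (fun x => (x, false))

/-- The measure on `[0,1]` with Lebesgue density `p`. -/
def unitDensity (p : ℝ → ℝ) : Measure ℝ :=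
  (volume.restrict (Icc (0:ℝ) 1)).withDensity fun x => ENNReal.ofReal (p x)

/-- The `j`-th bin `[j/K, (j+1)/K)`. -/
abbrev bin (K j : ℕ) : Set ℝ := Ico ((j:ℝ)/(K:ℝ)) (((j:ℝ)+1)/(K:ℝ))

lemma aemeasurable_of_integral_eq_one {p : ℝ → ℝ} (hp : (∫ x in Icc (0:ℝ) 1, p x) = 1) :
    AEMeasurable p (volume.restrict (Icc (0:ℝ) 1)) :=
  (Integrable.of_integral_ne_zero (by simp [hp])).aemeasurable

lemma isProbabilityMeasure_unitDensity {p : ℝ → ℝ} (h0 : ∀ x, 0 ≤ p x)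
    (hp : (∫ x in Icc (0:ℝ) 1, p x) = 1) : IsProbabilityMeasure (unitDensity p) := by
  have hi : Integrable p (volume.restrict (Icc (0:ℝ) 1)) :=
    Integrable.of_integral_ne_zero (by simp [hp])
  refine ⟨?_⟩
  rw [unitDensity, withDensity_apply _ MeasurableSet.univ, Measure.restrict_univ,
    ← ofReal_integral_eq_lintegral_ofReal hi (ae_of_all _ h0), hp, ENNReal.ofReal_one]

lemma covMeasure_eq_regMeasure {p η : ℝ → ℝ} (h0 : ∀ x, 0 ≤ p x)
    (hp : AEMeasurable p (volume.restrict (Icc (0:ℝ) 1)))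
    (hη : AEMeasurable η (volume.restrict (Icc (0:ℝ) 1))) :
    covMeasure p η = regMeasure (unitDensity p) η := by
  have key : ∀ ξ : ℝ → ℝ, AEMeasurable ξ (volume.restrict (Icc (0:ℝ) 1)) →
      (volume.restrict (Icc (0:ℝ) 1)).withDensity (fun x => ENNReal.ofReal (p x * ξ x)) =
        (unitDensity p).withDensity fun x => ENNReal.ofReal (ξ x) := by
    intro ξ hξ
    rw [unitDensity, ← withDensity_mul₀ hp.ennreal_ofReal hξ.ennreal_ofReal]
    congr 1
    funext x
    exact ENNReal.ofReal_mul (h0 x)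
  rw [covMeasure, labelMeasure, labelMeasure, regMeasure, key η hη,
    key (fun x => 1 - η x) (aemeasurable_const.sub hη)]

lemma testMeasure_regMeasure (μ ν : Measure ℝ) [SFinite μ] [SFinite ν] (η : ℝ → ℝ) :
    testMeasure (regMeasure μ η) (regMeasure ν η) =
      regMeasure ((2 : ℝ≥0∞)⁻¹ • μ + (2 : ℝ≥0∞)⁻¹ • ν) η := by
  simp only [testMeasure, regMeasure, withDensity_add_measure, withDensity_smul_measure, smul_add]
  rw [Measure.map_add _ _ (by fun_prop), Measure.map_add _ _ (by fun_prop)]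
  simp only [Measure.map_smul]
  abel

lemma regMeasure_apply (μ : Measure ℝ) (η : ℝ → ℝ) {T : Set (ℝ × Bool)} (hT : MeasurableSet T) :
    regMeasure μ η T = (∫⁻ x in {x | (x, true) ∈ T}, ENNReal.ofReal (η x) ∂μ) +
      ∫⁻ x in {x | (x, false) ∈ T}, ENNReal.ofReal (1 - η x) ∂μ := by
  have hm : ∀ b : Bool, Measurable fun x : ℝ => (x, b) := fun b => by fun_prop
  rw [regMeasure, Measure.add_apply, Measure.map_apply (hm _) hT, Measure.map_apply (hm _) hT,
    withDensity_apply _ (hm _ hT), withDensity_apply _ (hm _ hT)]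
  rfl

lemma regMeasure_prod_true (μ : Measure ℝ) (η : ℝ → ℝ) {I : Set ℝ} (hI : MeasurableSet I) :
    regMeasure μ η (I ×ˢ {true}) = ∫⁻ x in I, ENNReal.ofReal (η x) ∂μ := by
  rw [regMeasure_apply _ _ (hI.prod (measurableSet_singleton _))]
  simp

lemma regMeasure_prod_false (μ : Measure ℝ) (η : ℝ → ℝ) {I : Set ℝ} (hI : MeasurableSet I) :
    regMeasure μ η (I ×ˢ {false}) = ∫⁻ x in I, ENNReal.ofReal (1 - η x) ∂μ := by
  rw [regMeasure_apply _ _ (hI.prod (measurableSet_singleton _))]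
  simp

lemma regMeasure_prod_univ {μ : Measure ℝ} {η : ℝ → ℝ} (hm : AEMeasurable η μ)
    (hη : ∀ x, 0 ≤ η x ∧ η x ≤ 1) {I : Set ℝ} (hI : MeasurableSet I) :
    regMeasure μ η (I ×ˢ univ) = μ I := by
  rw [regMeasure_apply _ _ (hI.prod MeasurableSet.univ)]
  simp only [mem_prod, mem_univ, and_true, ofPred_mem_eq]
  rw [← lintegral_add_left' hm.ennreal_ofReal.restrict]
  have h1 : ∀ x, ENNReal.ofReal (η x) + ENNReal.ofReal (1 - η x) = 1 := fun x => by
    rw [← ENNReal.ofReal_add (hη x).1 (by linarith [(hη x).2])]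
    simp
  simp [h1]

lemma isProbabilityMeasure_regMeasure {μ : Measure ℝ} [IsProbabilityMeasure μ] {η : ℝ → ℝ}
    (hm : AEMeasurable η μ) (hη : ∀ x, 0 ≤ η x ∧ η x ≤ 1) :
    IsProbabilityMeasure (regMeasure μ η) :=
  ⟨by rw [← univ_prod_univ, regMeasure_prod_univ hm hη MeasurableSet.univ, measure_univ]⟩

/-- The pointwise Bayes error lower bounds the (outer) probability of error of any classifier,
measurable or not. -/
lemma lintegral_min_le_regMeasure (μ : Measure ℝ) (η : ℝ → ℝ) (f : ℝ → Bool) :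
    ∫⁻ x, min (ENNReal.ofReal (η x)) (ENNReal.ofReal (1 - η x)) ∂μ ≤
      regMeasure μ η {p | f p.1 ≠ p.2} := by
  set T := toMeasurable (regMeasure μ η) {p | f p.1 ≠ p.2}
  have hsub : {p : ℝ × Bool | f p.1 ≠ p.2} ⊆ T := subset_toMeasurable _ _
  have hcover : {x | (x, true) ∈ T} ∪ {x | (x, false) ∈ T} = univ := by
    refine eq_univ_of_forall fun x => ?_
    cases hx : f x
    · exact Or.inl (hsub (by simp [hx]))
    · exact Or.inr (hsub (by simp [hx]))
  rw [← measure_toMeasurable, regMeasure_apply _ _ (measurableSet_toMeasurable _ _),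
    ← setLIntegral_univ, ← hcover]
  exact (lintegral_union_le _ _ _).trans
    (add_le_add (lintegral_mono fun x => min_le_left _ _)
      (lintegral_mono fun x => min_le_right _ _))

lemma bin_subset_Icc {K j : ℕ} (hj : j < K) : bin K j ⊆ Icc 0 1 := by
  intro x hx
  have hK : (0:ℝ) < K := by exact_mod_cast (Nat.zero_le j).trans_lt hj
  have h1 : ((j:ℝ) + 1) / K ≤ 1 := (div_le_one hK).2 (by exact_mod_cast hj)
  exact ⟨le_trans (by positivity) hx.1, hx.2.le.trans h1⟩

lemma floor_of_mem_bin {K j : ℕ} (hK : 0 < K) {x : ℝ} (hx : x ∈ bin K j) :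
    ⌊x * (K:ℝ)⌋₊ = j := by
  have hK' : (0:ℝ) < K := by exact_mod_cast hK
  have h1 := (div_le_iff₀ hK').1 hx.1
  have h2 := (lt_div_iff₀ hK').1 hx.2
  exact (Nat.floor_eq_iff ((Nat.cast_nonneg j).trans h1)).2 ⟨h1, h2⟩

lemma exists_mem_bin {K : ℕ} (hK : 0 < K) {x : ℝ} (hx : x ∈ Ico (0:ℝ) 1) :
    ∃ j : Fin K, x ∈ bin K j := by
  have hK' : (0:ℝ) < K := by exact_mod_cast hK
  have hxK : 0 ≤ x * (K:ℝ) := mul_nonneg hx.1 hK'.le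
  refine ⟨⟨⌊x * (K:ℝ)⌋₊, (Nat.floor_lt hxK).2 (by nlinarith [hx.2])⟩, ?_, ?_⟩
  · exact (div_le_iff₀ hK').2 (Nat.floor_le hxK)
  · exact (lt_div_iff₀ hK').2 (Nat.lt_floor_add_one _)

lemma pairwise_disjoint_bin {K : ℕ} (hK : 0 < K) :
    Pairwise (Function.onFun Disjoint fun j : Fin K => bin K j) := by
  intro i j hij
  refine Set.disjoint_left.2 fun x hi hj => hij (Fin.ext ?_)
  rw [← floor_of_mem_bin hK hi, ← floor_of_mem_bin hK hj]

/-- On a bin of width `1/K` the best constant prediction loses at most `2/K` pointwise. -/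
lemma min_regMeasure_bin_le (μ : Measure ℝ) {η : ℝ → ℝ} (hη : ∀ x, 0 ≤ η x ∧ η x ≤ 1)
    (hL : LipschitzOnWith 1 η (Icc 0 1)) {K j : ℕ} (hj : j < K) :
    min (regMeasure μ η (bin K j ×ˢ {true})) (regMeasure μ η (bin K j ×ˢ {false})) ≤
      ∫⁻ x in bin K j, (min (ENNReal.ofReal (η x)) (ENNReal.ofReal (1 - η x)) +
        ENNReal.ofReal (2 / K)) ∂μ := by
  have hK : (0:ℝ) < K := by exact_mod_cast (Nat.zero_le j).trans_lt hj
  rw [regMeasure_prod_true _ _ measurableSet_Ico, regMeasure_prod_false _ _ measurableSet_Ico]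
  have hleft : (j:ℝ) / K ∈ bin K j := ⟨le_rfl, by gcongr; linarith⟩
  have hdist : ∀ x ∈ bin K j, |η x - η ((j:ℝ) / K)| ≤ 1 / K := by
    intro x hx
    have h := hL.dist_le_mul x (bin_subset_Icc hj hx) _ (bin_subset_Icc hj hleft)
    rw [Real.dist_eq, Real.dist_eq, NNReal.coe_one, one_mul,
      abs_of_nonneg (sub_nonneg.2 hx.1)] at h
    have h2 := hx.2
    rw [add_div] at h2
    linarith
  have h2K : (2:ℝ) / K = 1 / K + 1 / K := by ring
  rcases le_total (η ((j:ℝ) / K)) (1 / 2) with h | h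
  · refine (min_le_left _ _).trans (setLIntegral_mono' measurableSet_Ico fun x hx => ?_)
    have hx' := abs_le.1 (hdist x hx)
    rw [← ENNReal.ofReal_min, ← ENNReal.ofReal_add
      (le_min (hη x).1 (by linarith [(hη x).2])) (by positivity)]
    refine ENNReal.ofReal_le_ofReal ?_
    rw [← sub_le_iff_le_add]
    exact le_min (by rw [sub_le_self_iff]; positivity) (by linarith)
  · refine (min_le_right _ _).trans (setLIntegral_mono' measurableSet_Ico fun x hx => ?_)
    have hx' := abs_le.1 (hdist x hx)
    rw [← ENNReal.ofReal_min, ← ENNReal.ofReal_add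
      (le_min (hη x).1 (by linarith [(hη x).2])) (by positivity)]
    refine ENNReal.ofReal_le_ofReal ?_
    rw [← sub_le_iff_le_add]
    exact le_min (by linarith) (by rw [sub_le_self_iff]; positivity)

lemma sum_min_regMeasure_bin_le (μ : Measure ℝ) [IsProbabilityMeasure μ] {η : ℝ → ℝ}
    (hη : ∀ x, 0 ≤ η x ∧ η x ≤ 1) (hL : LipschitzOnWith 1 η (Icc 0 1)) {K : ℕ} (hK : 0 < K) :
    ∑ j : Fin K, min (regMeasure μ η (bin K j ×ˢ {true})) (regMeasure μ η (bin K j ×ˢ {false})) ≤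
      (∫⁻ x, min (ENNReal.ofReal (η x)) (ENNReal.ofReal (1 - η x)) ∂μ) +
        ENNReal.ofReal (2 / K) := by
  refine (Finset.sum_le_sum fun j _ => min_regMeasure_bin_le μ hη hL j.2).trans ?_
  rw [← tsum_fintype (L := .unconditional _), ← lintegral_iUnion (fun j => measurableSet_Ico) (pairwise_disjoint_bin hK)]
  refine (setLIntegral_le_lintegral _ _).trans ?_
  rw [lintegral_add_right _ measurable_const]
  simp

lemma sum_min_bin_le_bayesRisk (μ : Measure ℝ) [IsProbabilityMeasure μ] {η : ℝ → ℝ}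
    (hm : AEMeasurable η μ) (hη : ∀ x, 0 ≤ η x ∧ η x ≤ 1)
    (hL : LipschitzOnWith 1 η (Icc 0 1)) {K : ℕ} (hK : 0 < K) :
    ∑ j : Fin K, min (regMeasure μ η (bin K j ×ˢ {true})).toReal
        (regMeasure μ η (bin K j ×ˢ {false})).toReal ≤
      bayesRisk (regMeasure μ η) + 2 / K := by
  have := isProbabilityMeasure_regMeasure hm hη
  rw [← sub_le_iff_le_add]
  refine le_ciInf fun f => ?_
  rw [sub_le_iff_le_add, risk]
  have h := (sum_min_regMeasure_bin_le μ hη hL hK).trans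
    (add_le_add_left (lintegral_min_le_regMeasure μ η f) _)
  have h' := ENNReal.toReal_mono (by simp) h
  rw [ENNReal.toReal_sum (fun j _ => by simp),
    ENNReal.toReal_add (by simp) (by simp), ENNReal.toReal_ofReal (by positivity)] at h'
  simpa [ENNReal.toReal_min] using h'

lemma measurable_usbBinPred (nmaj nmin K : ℕ) (s : Finset (Fin nmaj)) (j : ℕ) :
    Measurable fun S => usbBinPred nmaj nmin K s S j := by
  have hset : ∀ b : Bool, MeasurableSet {p : ℝ × Bool | p.2 = b ∧ p.1 ∈ bin K j} := fun b =>
    (measurable_snd (measurableSet_singleton b)).inter (measurable_fst measurableSet_Ico)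
  have hmaj : ∀ b : Bool, Measurable fun S : Sample nmaj nmin =>
      (s.filter fun i => (S.1 i).2 = b ∧ (S.1 i).1 ∈ bin K j).card := by
    intro b
    simp only [Finset.card_filter]
    refine Finset.measurable_fun_sum _ fun i _ => Measurable.ite ?_ measurable_const measurable_const
    have hi : Measurable fun S : Sample nmaj nmin => S.1 i := by fun_prop
    exact hi (hset b)
  have hmin : ∀ b : Bool, Measurable fun S : Sample nmaj nmin =>
      (Finset.univ.filter fun i : Fin nmin => (S.2 i).2 = b ∧ (S.2 i).1 ∈ bin K j).card := by
    intro b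
    simp only [Finset.card_filter]
    refine Finset.measurable_fun_sum _ fun i _ => Measurable.ite ?_ measurable_const measurable_const
    have hi : Measurable fun S : Sample nmaj nmin => S.2 i := by fun_prop
    exact hi (hset b)
  refine measurable_to_bool ?_
  convert measurableSet_lt ((hmaj false).add (hmin false)) ((hmaj true).add (hmin true)) using 1
  ext S
  simp [usbBinPred]

lemma integrable_binExcess (nmaj nmin K : ℕ) (s : Finset (Fin nmaj)) (P : Measure (ℝ × Bool))
    (Q : Measure (Sample nmaj nmin)) [IsFiniteMeasure Q] (j : ℕ) :
    Integrable (fun S => binExcess nmaj nmin K s S P j) Q :=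
  (Integrable.of_finite (f := fun b : Bool =>
    qBin P K j (!b) - min (qBin P K j true) (qBin P K j false))).comp_measurable
      (measurable_usbBinPred nmaj nmin K s j)

lemma qBin_mul (P : Measure (ℝ × Bool)) [IsFiniteMeasure P] (K j : ℕ) (y : Bool) :
    qBin P K j y * (P (bin K j ×ˢ univ)).toReal = (P (bin K j ×ˢ {y})).toReal := by
  refine div_mul_cancel_of_imp fun h => ?_
  have h0 : P (bin K j ×ˢ univ) = 0 := by simpa [ENNReal.toReal_eq_zero_iff] using h
  rw [measure_mono_null (prod_mono_right (subset_univ _)) h0, ENNReal.toReal_zero]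

lemma binExcess_mul (nmaj nmin K : ℕ) (s : Finset (Fin nmaj)) (S : Sample nmaj nmin)
    (P : Measure (ℝ × Bool)) [IsFiniteMeasure P] (j : ℕ) :
    binExcess nmaj nmin K s S P j * (P (bin K j ×ˢ univ)).toReal =
      (P (bin K j ×ˢ {!usbBinPred nmaj nmin K s S j})).toReal -
        min (P (bin K j ×ˢ {true})).toReal (P (bin K j ×ˢ {false})).toReal := by
  rw [binExcess, sub_mul, min_mul_of_nonneg _ _ ENNReal.toReal_nonneg, qBin_mul, qBin_mul, qBin_mul]

lemma risk_usbClassifier_le (nmaj nmin : ℕ) {K : ℕ} (hK : 0 < K) (s : Finset (Fin nmaj))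
    (S : Sample nmaj nmin) (P : Measure (ℝ × Bool)) [IsFiniteMeasure P]
    (hP : P ((Ico (0:ℝ) 1)ᶜ ×ˢ univ) = 0) :
    risk (usbClassifier nmaj nmin K s S) P ≤
      ∑ j : Fin K, (P (bin K j ×ˢ {!usbBinPred nmaj nmin K s S j})).toReal := by
  have hsub : {p : ℝ × Bool | usbClassifier nmaj nmin K s S p.1 ≠ p.2} ⊆
      (⋃ j : Fin K, bin K j ×ˢ {!usbBinPred nmaj nmin K s S j}) ∪ (Ico (0:ℝ) 1)ᶜ ×ˢ univ := by
    rintro ⟨x, y⟩ hxy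
    by_cases hx : x ∈ Ico (0:ℝ) 1
    · obtain ⟨j, hj⟩ := exists_mem_bin hK hx
      refine Or.inl (mem_iUnion.2 ⟨j, hj, ?_⟩)
      have hmin : min (j:ℕ) (K - 1) = j := min_eq_left (Nat.le_sub_one_of_lt j.2)
      simp only [usbClassifier, mem_ofPred_eq, floor_of_mem_bin hK hj, hmin] at hxy
      exact (Bool.eq_not_of_ne hxy.symm)
    · exact Or.inr ⟨hx, mem_univ _⟩
  have h := (measure_mono hsub).trans (measure_union_le (μ := P) _ _)
  rw [hP, add_zero] at h
  rw [risk, ← ENNReal.toReal_sum (fun j _ => measure_ne_top _ _)]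
  exact ENNReal.toReal_mono (by simp) (h.trans (measure_iUnion_fintype_le _ _))

lemma integral_risk_usbClassifier_le (nmaj nmin : ℕ) {K : ℕ} (hK : 0 < K) (s : Finset (Fin nmaj))
    (P : Measure (ℝ × Bool)) [IsFiniteMeasure P] (hP : P ((Ico (0:ℝ) 1)ᶜ ×ˢ univ) = 0)
    (Q : Measure (Sample nmaj nmin)) [IsProbabilityMeasure Q] :
    ∫ S, risk (usbClassifier nmaj nmin K s S) P ∂Q ≤
      (∑ j : Fin K, (∫ S, binExcess nmaj nmin K s S P j ∂Q) * (P (bin K j ×ˢ univ)).toReal) +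
        ∑ j : Fin K, min (P (bin K j ×ˢ {true})).toReal (P (bin K j ×ˢ {false})).toReal := by
  set C := ∑ j : Fin K, min (P (bin K j ×ˢ {true})).toReal (P (bin K j ×ˢ {false})).toReal
  have hint : ∀ j : Fin K, Integrable (fun S => binExcess nmaj nmin K s S P j *
      (P (bin K j ×ˢ univ)).toReal) Q := fun j =>
    (integrable_binExcess nmaj nmin K s P Q j).mul_const _
  have hsum : Integrable (fun S => ∑ j : Fin K, binExcess nmaj nmin K s S P j *
      (P (bin K j ×ˢ univ)).toReal) Q := integrable_finsetSum _ fun j _ => hint j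
  calc ∫ S, risk (usbClassifier nmaj nmin K s S) P ∂Q
      ≤ ∫ S, ((∑ j : Fin K, binExcess nmaj nmin K s S P j *
          (P (bin K j ×ˢ univ)).toReal) + C) ∂Q := by
        refine integral_mono_of_nonneg (ae_of_all _ fun S => ENNReal.toReal_nonneg)
          (hsum.add (integrable_const C)) (ae_of_all _ fun S => ?_)
        refine (risk_usbClassifier_le nmaj nmin hK s S P hP).trans_eq ?_
        simp only [binExcess_mul, Finset.sum_sub_distrib, C, sub_add_cancel]
    _ = _ := by
        rw [integral_add hsum (integrable_const C), integral_finsetSum _ fun j _ => hint j]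
        simp [integral_mul_const]

/-- **Lemma (decomposition of the excess risk of undersampled binning).** For
`(P_maj, P_min) ∈ 𝒫_GS(τ)` and the undersampled binning estimator with `K` bins,
`ExcessRisk[A_USB] ≤ Σ_{j=1}^K E_S[R_j(A_USB^S)] · P_test(I_j) + 2/K`. -/
theorem usb_excess_risk_decomposition
    (nmaj nmin K : ℕ) (hmin : 1 ≤ nmin) (hmaj : nmin < nmaj) (hK : 0 < K)
    (τ : ℝ) (hτ : τ ∈ Icc (0:ℝ) 1)
    (Pmaj Pmin : Measure (ℝ × Bool)) (hmem : memGS τ Pmaj Pmin) :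
    usbExcessRisk nmaj nmin K Pmaj Pmin ≤
      (∑ j : Fin K,
        ((∑ s ∈ Finset.powersetCard nmin (Finset.univ : Finset (Fin nmaj)),
            ∫ S, binExcess nmaj nmin K s S (testMeasure Pmaj Pmin) (j : ℕ)
              ∂sampleMeasure nmaj nmin Pmaj Pmin)
          / ((Finset.powersetCard nmin (Finset.univ : Finset (Fin nmaj))).card : ℝ))
        * ((testMeasure Pmaj Pmin)
            ((Ico (((j:ℕ):ℝ)/(K:ℝ)) ((((j:ℕ):ℝ)+1)/(K:ℝ))) ×ˢ (univ : Set Bool))).toReal)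
      + 2/(K:ℝ) := by
  obtain ⟨pa, pb, η, ha0, hb0, ha, hb, hη, hL, -, -, rfl, rfl⟩ := hmem
  have hηm : AEMeasurable η (volume.restrict (Icc (0:ℝ) 1)) :=
    hL.continuousOn.aemeasurable measurableSet_Icc
  have := isProbabilityMeasure_unitDensity ha0 ha
  have := isProbabilityMeasure_unitDensity hb0 hb
  have hac : ∀ p, unitDensity p ≪ volume.restrict (Icc (0:ℝ) 1) := fun p =>
    withDensity_absolutelyContinuous _ _
  rw [covMeasure_eq_regMeasure ha0 (aemeasurable_of_integral_eq_one ha) hηm,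
    covMeasure_eq_regMeasure hb0 (aemeasurable_of_integral_eq_one hb) hηm]
  have := isProbabilityMeasure_regMeasure (hηm.mono_ac (hac pa)) hη
  have := isProbabilityMeasure_regMeasure (hηm.mono_ac (hac pb)) hη
  set Q := sampleMeasure nmaj nmin (regMeasure (unitDensity pa) η) (regMeasure (unitDensity pb) η)
    with hQ
  have : IsProbabilityMeasure Q := by rw [hQ, sampleMeasure]; infer_instance
  rw [usbExcessRisk, ← hQ, testMeasure_regMeasure]
  set μ := (2 : ℝ≥0∞)⁻¹ • unitDensity pa + (2 : ℝ≥0∞)⁻¹ • unitDensity pb with hμ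
  have hμprob : IsProbabilityMeasure μ := ⟨by simp [hμ, ENNReal.inv_two_add_inv_two]⟩
  have hμac : μ ≪ volume.restrict (Icc (0:ℝ) 1) :=
    ((hac pa).smul_left _).add_left ((hac pb).smul_left _)
  have hμm : AEMeasurable η μ := hηm.mono_ac hμac
  set P := regMeasure μ η with hPdef
  have hPprob : IsProbabilityMeasure P := isProbabilityMeasure_regMeasure hμm hη
  have hP : P ((Ico (0:ℝ) 1)ᶜ ×ˢ univ) = 0 := by
    rw [hPdef, regMeasure_prod_univ hμm hη measurableSet_Ico.compl]
    refine hμac ?_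
    rw [← restrict_Ico_eq_restrict_Icc, Measure.restrict_apply measurableSet_Ico.compl]
    simp
  have hbayes := sum_min_bin_le_bayesRisk μ hμm hη hL hK
  rw [← hPdef] at hbayes
  set F := Finset.powersetCard nmin (Finset.univ : Finset (Fin nmaj))
  have hF : (0:ℝ) < F.card := by
    have : 0 < F.card := by simpa [F] using Nat.choose_pos hmaj.le
    exact_mod_cast this
  rw [sub_le_iff_le_add, div_le_iff₀ hF]
  refine (Finset.sum_le_sum fun s _ =>
    (integral_risk_usbClassifier_le nmaj nmin hK s P hP Q).trans
      (add_le_add_right hbayes _)).trans_eq ?_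
  rw [Finset.sum_add_distrib, Finset.sum_const, nsmul_eq_mul, Finset.sum_comm, add_assoc, add_mul,
    Finset.sum_mul]
  congr 1
  · refine Finset.sum_congr rfl fun j _ => ?_
    rw [← Finset.sum_mul]
    field_simp
  · ring
end
end

section
/- There is an absolute constant c > 0 such that for any τ ∈ [0,1], any (P_maj, P_min) ∈ P_GS(τ), and any j ∈ {1,…,K}, the expected excess risk of the undersampled binning estimator in interval I_j = [(j−1)/K, j/K] satisfies E_{S ~ P_maj^{n_maj} × P_min^{n_min}}[ R_j(A_USB^S) ] ≤ c/√(n_min · P_test(I_j)) + c/K, where P_test(I_j) = ∫_{I_j} P_test(x) dx. -/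
open MeasureTheory Set
open scoped ENNReal Classical

noncomputable section

open ProbabilityTheory

/-- The signed vote of a labelled example for the label on `I`: `1` or `-1` according to the label
if the feature lies in `I`, and `0` otherwise. -/
def binVote (I : Set ℝ) (p : ℝ × Bool) : ℝ :=
  (I ×ˢ {true}).indicator 1 p - (I ×ˢ {false}).indicator 1 p

/-- The sum of the signed votes on `I` of the undersampled dataset. -/
def voteMargin {nmaj nmin : ℕ} (s : Finset (Fin nmaj)) (I : Set ℝ) (S : Sample nmaj nmin) : ℝ :=
  ∑ i ∈ s, binVote I (S.1 i) + ∑ i, binVote I (S.2 i)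

lemma binVote_sq (I : Set ℝ) (p : ℝ × Bool) :
    binVote I p ^ 2 = (I ×ˢ (univ : Set Bool)).indicator 1 p := by
  obtain ⟨x, y⟩ := p
  by_cases hx : x ∈ I <;> cases y <;> simp [binVote, hx, indicator]

lemma measurable_binVote {I : Set ℝ} (hI : MeasurableSet I) : Measurable (binVote I) :=
  (measurable_one.indicator (hI.prod (measurableSet_singleton _))).sub
    (measurable_one.indicator (hI.prod (measurableSet_singleton _)))

lemma memLp_binVote {I : Set ℝ} (hI : MeasurableSet I) (P : Measure (ℝ × Bool))
    [IsFiniteMeasure P] : MemLp (binVote I) 2 P := by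
  refine MemLp.of_bound (measurable_binVote hI).aestronglyMeasurable 1 (ae_of_all _ fun p => ?_)
  obtain ⟨x, y⟩ := p
  by_cases hx : x ∈ I <;> cases y <;> simp [binVote, hx, indicator]

lemma integral_binVote {I : Set ℝ} (hI : MeasurableSet I) (P : Measure (ℝ × Bool))
    [IsFiniteMeasure P] :
    ∫ p, binVote I p ∂P = P.real (I ×ˢ {true}) - P.real (I ×ˢ {false}) := by
  have h (y : Bool) : MeasurableSet (I ×ˢ ({y} : Set Bool)) := hI.prod (measurableSet_singleton _)
  unfold binVote
  rw [integral_sub ((integrable_const 1).indicator (h _)) ((integrable_const 1).indicator (h _)),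
    integral_indicator_one (h _), integral_indicator_one (h _)]

lemma variance_binVote_le {I : Set ℝ} (hI : MeasurableSet I) (P : Measure (ℝ × Bool))
    [IsProbabilityMeasure P] :
    Var[binVote I; P] ≤ P.real (I ×ˢ (univ : Set Bool)) := by
  refine (variance_le_expectation_sq (measurable_binVote hI).aestronglyMeasurable).trans_eq ?_
  rw [← integral_indicator_one (hI.prod MeasurableSet.univ)]
  exact integral_congr_ae (ae_of_all _ (binVote_sq I))

section IndependentSums

variable {ι Ω : Type*} [Fintype ι] [MeasurableSpace Ω] {P : Measure Ω} [IsProbabilityMeasure P]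
  {g : Ω → ℝ}

lemma memLp_sum_comp_eval_pi (hg : MemLp g 2 P) (s : Finset ι) :
    MemLp (fun ω : ι → Ω => ∑ i ∈ s, g (ω i)) 2 (Measure.pi fun _ => P) :=
  memLp_finsetSum s fun i _ => hg.comp_measurePreserving (measurePreserving_eval (fun _ => P) i)

lemma integral_sum_comp_eval_pi (hg : MemLp g 2 P) (s : Finset ι) :
    ∫ ω : ι → Ω, ∑ i ∈ s, g (ω i) ∂(Measure.pi fun _ => P) = s.card * ∫ x, g x ∂P := by
  have h (i : ι) : Integrable (fun ω : ι → Ω => g (ω i)) (Measure.pi fun _ => P) :=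
    (hg.comp_measurePreserving (measurePreserving_eval (fun _ => P) i)).integrable one_le_two
  rw [integral_finsetSum _ fun i _ => h i]
  simp [integral_comp_eval (μ := fun _ : ι => P) hg.aestronglyMeasurable]

lemma variance_sum_comp_eval_pi (hg : MemLp g 2 P) (s : Finset ι) :
    Var[fun ω : ι → Ω => ∑ i ∈ s, g (ω i); Measure.pi fun _ => P] = s.card * Var[g; P] := by
  have h := variance_sum_pi (μ := fun _ : ι => P) (X := fun i => if i ∈ s then g else 0)
    (fun i => by split_ifs <;> simp [hg])
  have e : (∑ i, fun ω : ι → Ω => (if i ∈ s then g else 0) (ω i))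
      = fun ω => ∑ i ∈ s, g (ω i) := by
    ext ω
    simp [Finset.sum_apply, ite_apply]
  rw [← e, h]
  simp [apply_ite (fun f => Var[f; P])]

end IndependentSums

section Margin

variable {nmaj nmin : ℕ} {Pmaj Pmin : Measure (ℝ × Bool)} [IsProbabilityMeasure Pmaj]
  [IsProbabilityMeasure Pmin] {I : Set ℝ}

instance : IsProbabilityMeasure (sampleMeasure nmaj nmin Pmaj Pmin) := by
  unfold sampleMeasure
  infer_instance

instance : IsProbabilityMeasure (testMeasure Pmaj Pmin) :=
  ⟨by simp [testMeasure, ENNReal.inv_two_add_inv_two]⟩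

lemma testMeasure_real (A : Set (ℝ × Bool)) :
    (testMeasure Pmaj Pmin).real A = (Pmaj.real A + Pmin.real A) / 2 := by
  simp only [testMeasure, measureReal_def, Measure.add_apply, Measure.smul_apply, smul_eq_mul]
  rw [ENNReal.toReal_add (by finiteness) (by finiteness)]
  simp
  ring

lemma memLp_voteMargin (hI : MeasurableSet I) (s : Finset (Fin nmaj)) :
    MemLp (voteMargin (nmin := nmin) s I) 2 (sampleMeasure nmaj nmin Pmaj Pmin) :=
  ((memLp_sum_comp_eval_pi (memLp_binVote hI Pmaj) s).comp_fst _).add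
    ((memLp_sum_comp_eval_pi (memLp_binVote hI Pmin) Finset.univ).comp_snd _)

lemma integral_voteMargin (hI : MeasurableSet I) {s : Finset (Fin nmaj)} (hs : s.card = nmin) :
    ∫ S : Sample nmaj nmin, voteMargin s I S ∂sampleMeasure nmaj nmin Pmaj Pmin
      = 2 * nmin * ((testMeasure Pmaj Pmin).real (I ×ˢ {true})
          - (testMeasure Pmaj Pmin).real (I ×ˢ {false})) := by
  have h1 := memLp_sum_comp_eval_pi (memLp_binVote hI Pmaj) s
  have h2 := memLp_sum_comp_eval_pi (memLp_binVote hI Pmin) (Finset.univ : Finset (Fin nmin))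
  unfold voteMargin sampleMeasure
  rw [integral_add ((h1.comp_fst _).integrable one_le_two) ((h2.comp_snd _).integrable one_le_two),
    integral_fun_fst (fun ω : Fin nmaj → ℝ × Bool => ∑ i ∈ s, binVote I (ω i)),
    integral_fun_snd (fun ω : Fin nmin → ℝ × Bool => ∑ i, binVote I (ω i)),
    integral_sum_comp_eval_pi (memLp_binVote hI Pmaj),
    integral_sum_comp_eval_pi (memLp_binVote hI Pmin),
    integral_binVote hI, integral_binVote hI, testMeasure_real, testMeasure_real]
  simp [hs]
  ring

lemma variance_voteMargin_le (hI : MeasurableSet I) {s : Finset (Fin nmaj)}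
    (hs : s.card = nmin) :
    Var[voteMargin (nmin := nmin) s I; sampleMeasure nmaj nmin Pmaj Pmin]
      ≤ 2 * nmin * (testMeasure Pmaj Pmin).real (I ×ˢ (univ : Set Bool)) := by
  have h := variance_add_prod (memLp_sum_comp_eval_pi (memLp_binVote hI Pmaj) s)
    (memLp_sum_comp_eval_pi (memLp_binVote hI Pmin) (Finset.univ : Finset (Fin nmin)))
  unfold voteMargin sampleMeasure
  rw [h, variance_sum_comp_eval_pi (memLp_binVote hI Pmaj),
    variance_sum_comp_eval_pi (memLp_binVote hI Pmin), testMeasure_real, hs, Finset.card_univ,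
    Fintype.card_fin]
  have h1 := mul_le_mul_of_nonneg_left (variance_binVote_le hI Pmaj) (Nat.cast_nonneg (α := ℝ) nmin)
  have h2 := mul_le_mul_of_nonneg_left (variance_binVote_le hI Pmin) (Nat.cast_nonneg (α := ℝ) nmin)
  linarith

end Margin

lemma usbBinPred_eq_true_iff {nmaj nmin : ℕ} (K : ℕ) (s : Finset (Fin nmaj))
    (S : Sample nmaj nmin) (j : ℕ) :
    usbBinPred nmaj nmin K s S j = true
      ↔ 0 < voteMargin s (Ico ((j : ℝ) / K) (((j : ℝ) + 1) / K)) S := by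
  have e (y : Bool) (a b : ℝ) (p : ℝ × Bool) :
      (Ico a b ×ˢ ({y} : Set Bool)).indicator (1 : ℝ × Bool → ℝ) p
        = if p.2 = y ∧ p.1 ∈ Ico a b then 1 else 0 := by
    simp only [indicator, mem_prod, mem_singleton_iff, and_comm, Pi.one_apply]
  rw [usbBinPred, decide_eq_true_iff, ← Nat.cast_lt (α := ℝ)]
  simp only [voteMargin, binVote, e, Finset.sum_sub_distrib, Nat.cast_add,
    Finset.natCast_card_filter]
  constructor <;> intro h <;> linarith

lemma abs_nonpos_or_pos_sub_min_le {n m t f D : ℝ} (hn : 0 < n) (hm : 0 < m) {b : Bool}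
    (hb : b = true ↔ 0 < D) :
    (bif b then f / m else t / m) - min (t / m) (f / m) ≤ |D - n * (t - f)| / (n * m) := by
  have key : (bif b then f else t) - min t f ≤ |D - n * (t - f)| / n := by
    rw [le_div_iff₀ hn]
    cases b with
    | true =>
      have hD : 0 < D := hb.1 rfl
      rcases le_total t f with h | h
      · rw [min_eq_left h]
        refine le_trans ?_ (le_abs_self _)
        simp only [cond_true]
        nlinarith
      · simp [min_eq_right h]
    | false =>
      have hD : D ≤ 0 := not_lt.1 fun h => by simpa using hb.2 h
      rcases le_total t f with h | h
      · simp [min_eq_left h]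
      · rw [min_eq_right h]
        refine le_trans ?_ (neg_le_abs _)
        simp only [cond_false]
        nlinarith
  rw [← div_div]
  refine le_trans (le_of_eq ?_) (div_le_div_of_nonneg_right key hm.le)
  rw [min_div_div_right hm.le, sub_div]
  cases b <;> rfl

lemma binExcess_nonneg (nmaj nmin K : ℕ) (s : Finset (Fin nmaj)) (S : Sample nmaj nmin)
    (P : Measure (ℝ × Bool)) (j : ℕ) : 0 ≤ binExcess nmaj nmin K s S P j := by
  unfold binExcess
  cases usbBinPred nmaj nmin K s S j <;> simp

lemma integral_binExcess_le {nmaj nmin K : ℕ} (hn : 0 < nmin) {Pmaj Pmin : Measure (ℝ × Bool)}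
    [IsProbabilityMeasure Pmaj] [IsProbabilityMeasure Pmin] {s : Finset (Fin nmaj)}
    (hs : s.card = nmin) (j : ℕ) :
    ∫ S, binExcess nmaj nmin K s S (testMeasure Pmaj Pmin) j ∂sampleMeasure nmaj nmin Pmaj Pmin
      ≤ 1 / √(nmin * (testMeasure Pmaj Pmin).real
          (Ico ((j : ℝ) / K) (((j : ℝ) + 1) / K) ×ˢ (univ : Set Bool))) := by
  set I : Set ℝ := Ico ((j : ℝ) / K) (((j : ℝ) + 1) / K)
  have hI : MeasurableSet I := measurableSet_Ico
  set m := (testMeasure Pmaj Pmin).real (I ×ˢ (univ : Set Bool))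
  set t := (testMeasure Pmaj Pmin).real (I ×ˢ ({true} : Set Bool))
  set f := (testMeasure Pmaj Pmin).real (I ×ˢ ({false} : Set Bool))
  have hq (y : Bool) : qBin (testMeasure Pmaj Pmin) K j y
      = (testMeasure Pmaj Pmin).real (I ×ˢ ({y} : Set Bool)) / m := rfl
  rcases (measureReal_nonneg : 0 ≤ m).eq_or_lt with hm | hm
  · simp [binExcess, hq, show m = 0 from hm.symm]
  have hn' : (0 : ℝ) < nmin := by exact_mod_cast hn
  set v : ℝ := nmin * m with hv_def
  have hv : 0 < v := mul_pos hn' hm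
  have hr : 0 < √v := Real.sqrt_pos.2 hv
  have hr2 : √v ^ 2 = v := Real.sq_sqrt hv.le
  set D := voteMargin (nmin := nmin) s I
  set e : ℝ := 2 * nmin * (t - f)
  have hD : MemLp D 2 (sampleMeasure nmaj nmin Pmaj Pmin) := memLp_voteMargin hI s
  have hint : Integrable (fun S => (D S - e) ^ 2) (sampleMeasure nmaj nmin Pmaj Pmin) :=
    (hD.sub (memLp_const e)).integrable_sq
  have hvar : ∫ S, (D S - e) ^ 2 ∂sampleMeasure nmaj nmin Pmaj Pmin ≤ 2 * v := by
    have h := variance_voteMargin_le (Pmaj := Pmaj) (Pmin := Pmin) hI hs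
    rw [variance_eq_integral hD.aestronglyMeasurable.aemeasurable, integral_voteMargin hI hs] at h
    rw [hv_def, ← mul_assoc]
    exact h
  have hpt (S : Sample nmaj nmin) : binExcess nmaj nmin K s S (testMeasure Pmaj Pmin) j
      ≤ ((D S - e) ^ 2 / √v + √v) / (4 * v) := by
    have h1 : binExcess nmaj nmin K s S (testMeasure Pmaj Pmin) j ≤ |D S - e| / (2 * v) := by
      have h := abs_nonpos_or_pos_sub_min_le (n := 2 * nmin) (t := t) (f := f) (by positivity) hm
        (usbBinPred_eq_true_iff K s S j)
      rw [mul_assoc] at h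
      refine le_trans (le_of_eq ?_) (h.trans_eq (by simp only [e, hv_def, mul_assoc]; rfl))
      simp only [binExcess, hq]
      cases usbBinPred nmaj nmin K s S j <;> rfl
    refine h1.trans ?_
    have h2 : 2 * |D S - e| ≤ (D S - e) ^ 2 / √v + √v := by
      rw [div_add' _ _ _ hr.ne', le_div_iff₀ hr]
      nlinarith [sq_nonneg (|D S - e| - √v), sq_abs (D S - e)]
    rw [div_le_div_iff₀ (by positivity) (by positivity)]
    nlinarith
  calc ∫ S, binExcess nmaj nmin K s S (testMeasure Pmaj Pmin) j
        ∂sampleMeasure nmaj nmin Pmaj Pmin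
      ≤ ∫ S, ((D S - e) ^ 2 / √v + √v) / (4 * v) ∂sampleMeasure nmaj nmin Pmaj Pmin :=
        integral_mono_of_nonneg (ae_of_all _ fun S => binExcess_nonneg ..)
          (((hint.div_const _).add (integrable_const _)).div_const _) (ae_of_all _ hpt)
    _ = ((∫ S, (D S - e) ^ 2 ∂sampleMeasure nmaj nmin Pmaj Pmin) / √v + √v) / (4 * v) := by
        rw [integral_div, integral_add (hint.div_const _) (integrable_const _), integral_div]
        simp
    _ ≤ (2 * v / √v + √v) / (4 * v) := by gcongr
    _ ≤ 1 / √v := by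
        rw [div_add' _ _ _ hr.ne', div_div, div_le_div_iff₀ (by positivity) hr]
        nlinarith [mul_pos hv hr]

lemma isProbabilityMeasure_covMeasure {p η : ℝ → ℝ} (hp : ∀ x, 0 ≤ p x)
    (hp1 : ∫ x in Icc (0 : ℝ) 1, p x = 1) (hη : ∀ x, 0 ≤ η x ∧ η x ≤ 1)
    (hη_lip : LipschitzOnWith 1 η (Icc 0 1)) : IsProbabilityMeasure (covMeasure p η) := by
  have hint : Integrable p (volume.restrict (Icc (0 : ℝ) 1)) := by
    by_contra h
    simp [integral_undef h] at hp1
  have hη_meas : AEMeasurable η (volume.restrict (Icc (0 : ℝ) 1)) :=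
    hη_lip.continuousOn.aemeasurable measurableSet_Icc
  have hmass (q : ℝ → ℝ) (y : Bool) : labelMeasure q y univ
      = ∫⁻ x in Icc (0 : ℝ) 1, ENNReal.ofReal (q x) := by
    rw [labelMeasure, Measure.map_apply measurable_prodMk_right MeasurableSet.univ, preimage_univ,
      withDensity_apply _ MeasurableSet.univ, Measure.restrict_univ]
  constructor
  rw [covMeasure, Measure.add_apply, hmass, hmass,
    ← lintegral_add_left' (f := fun x => ENNReal.ofReal (p x * η x))
      (hint.aemeasurable.mul hη_meas).ennreal_ofReal]
  simp_rw [← ENNReal.ofReal_add (mul_nonneg (hp _) (hη _).1)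
    (mul_nonneg (hp _) (sub_nonneg.2 (hη _).2)), ← mul_add, add_sub_cancel, mul_one]
  rw [← ofReal_integral_eq_lintegral_ofReal hint (ae_of_all _ hp), hp1, ENNReal.ofReal_one]

/-- **Lemma (per-bin excess risk of undersampled binning).** There is an absolute constant
`c > 0` such that for any `τ ∈ [0,1]`, any `(P_maj, P_min) ∈ 𝒫_GS(τ)` and any bin `j`,
`E_S[R_j(A_USB^S)] ≤ c/√(n_min · P_test(I_j)) + c/K`. -/
theorem usb_per_bin_excess_risk_bound :
    ∃ c : ℝ, 0 < c ∧
      ∀ (nmaj nmin K : ℕ), 1 ≤ nmin → nmin < nmaj → 0 < K →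
        ∀ τ : ℝ, τ ∈ Icc (0:ℝ) 1 →
          ∀ Pmaj Pmin : Measure (ℝ × Bool), memGS τ Pmaj Pmin →
            ∀ j : Fin K,
              (∑ s ∈ Finset.powersetCard nmin (Finset.univ : Finset (Fin nmaj)),
                  ∫ S, binExcess nmaj nmin K s S (testMeasure Pmaj Pmin) (j : ℕ)
                    ∂sampleMeasure nmaj nmin Pmaj Pmin)
                / ((Finset.powersetCard nmin (Finset.univ : Finset (Fin nmaj))).card : ℝ)
              ≤ c / Real.sqrt ((nmin : ℝ) *
                  ((testMeasure Pmaj Pmin)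
                    ((Ico (((j:ℕ):ℝ)/(K:ℝ)) ((((j:ℕ):ℝ)+1)/(K:ℝ))) ×ˢ
                      (univ : Set Bool))).toReal)
                + c/(K:ℝ) := by
  refine ⟨1, one_pos, ?_⟩
  rintro nmaj nmin K hn - - τ - Pmaj Pmin ⟨pa, pb, η, ha, hb, ha1, hb1, hη, hη_lip, -, -, rfl, rfl⟩ j
  have := isProbabilityMeasure_covMeasure ha ha1 hη hη_lip
  have := isProbabilityMeasure_covMeasure hb hb1 hη hη_lip
  refine le_trans ?_ (le_add_of_nonneg_right (by positivity))
  refine div_le_of_le_mul₀ (Nat.cast_nonneg _) (by positivity) ?_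
  rw [mul_comm, ← nsmul_eq_mul]
  exact Finset.sum_le_card_nsmul _ _ _ fun s hs =>
    integral_binExcess_le hn (Finset.mem_powersetCard.1 hs).2 j
end
end

section
/- Let P_1, P_{−1} be probability densities on [0,1] with P_1(x) + P_{−1}(x) > 0 for all x, and let P̂_1, P̂_{−1} be nonnegative integrable functions on [0,1] with P̂_1(x) + P̂_{−1}(x) > 0 for all x. Define η(x) = P_1(x)/(P_1(x)+P_{−1}(x)), η̂(x) = P̂_1(x)/(P̂_1(x)+P̂_{−1}(x)), and p_test(x) = (P_1(x)+P_{−1}(x))/2. Then 2·∫₀¹ |η̂(x) − η(x)| · p_test(x) dx ≤ 2·∫₀¹ |P̂_1(x) − P_1(x)| dx + ∫₀¹ |P̂_{−1}(x) − P_{−1}(x)| dx. -/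
open MeasureTheory Set
open scoped ENNReal Classical

noncomputable section

/-- The error of a ratio `a / (a + b)` as an approximation of `p / (p + r)`, weighted by `p + r`,
is at most the sum of the errors of its ingredients. -/
theorem abs_ratio_sub_ratio_mul_le {a b p r : ℝ} (ha : 0 ≤ a) (hb : 0 ≤ b)
    (hab : 0 < a + b) (hpr : 0 < p + r) :
    |a / (a + b) - p / (p + r)| * (p + r) ≤ |a - p| + |b - r| := by
  have hab' := hab.ne'
  have hpr' := hpr.ne'
  have key : (a / (a + b) - p / (p + r)) * (p + r)
      = b / (a + b) * (a - p) - a / (a + b) * (b - r) := by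
    field_simp
    ring
  have h₁ : b / (a + b) ≤ 1 := (div_le_one hab).2 (by linarith)
  have h₂ : a / (a + b) ≤ 1 := (div_le_one hab).2 (by linarith)
  calc |a / (a + b) - p / (p + r)| * (p + r)
      = |b / (a + b) * (a - p) - a / (a + b) * (b - r)| := by
        rw [← key, abs_mul, abs_of_pos hpr]
    _ ≤ |b / (a + b) * (a - p)| + |a / (a + b) * (b - r)| := abs_sub _ _
    _ = b / (a + b) * |a - p| + a / (a + b) * |b - r| := by
        rw [abs_mul, abs_mul, abs_of_nonneg (div_nonneg hb hab.le),
          abs_of_nonneg (div_nonneg ha hab.le)]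
    _ ≤ |a - p| + |b - r| :=
        add_le_add (mul_le_of_le_one_left (abs_nonneg _) h₁)
          (mul_le_of_le_one_left (abs_nonneg _) h₂)

/-- **Lemma (plug-in L¹ bound).** Let `P₁, P₋₁` be probability densities on `[0,1]` with
`P₁ + P₋₁ > 0` pointwise, and let `P̂₁, P̂₋₁` be nonnegative integrable functions on `[0,1]`
with `P̂₁ + P̂₋₁ > 0` pointwise. With `η = P₁/(P₁+P₋₁)`, `η̂ = P̂₁/(P̂₁+P̂₋₁)` and
`p_test = (P₁+P₋₁)/2`,
`2∫₀¹ |η̂ - η| p_test ≤ 2∫₀¹ |P̂₁ - P₁| + ∫₀¹ |P̂₋₁ - P₋₁|`. -/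
theorem plugin_l1_bound
    (p1 pm1 q1 qm1 : ℝ → ℝ)
    (hp1m : Measurable p1) (hpm1m : Measurable pm1)
    (hq1m : Measurable q1) (hqm1m : Measurable qm1)
    (hp1 : ∀ x, 0 ≤ p1 x) (hpm1 : ∀ x, 0 ≤ pm1 x)
    (hq1 : ∀ x, 0 ≤ q1 x) (hqm1 : ∀ x, 0 ≤ qm1 x)
    (hp1i : IntegrableOn p1 (Icc (0:ℝ) 1))
    (hpm1i : IntegrableOn pm1 (Icc (0:ℝ) 1))
    (hq1i : IntegrableOn q1 (Icc (0:ℝ) 1))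
    (hqm1i : IntegrableOn qm1 (Icc (0:ℝ) 1))
    (hp1int : (∫ x in Icc (0:ℝ) 1, p1 x) = 1)
    (hpm1int : (∫ x in Icc (0:ℝ) 1, pm1 x) = 1)
    (hppos : ∀ x, 0 < p1 x + pm1 x) (hqpos : ∀ x, 0 < q1 x + qm1 x) :
    2 * (∫ x in Icc (0:ℝ) 1,
        |q1 x / (q1 x + qm1 x) - p1 x / (p1 x + pm1 x)| * ((p1 x + pm1 x)/2))
      ≤ 2 * (∫ x in Icc (0:ℝ) 1, |q1 x - p1 x|) +
          ∫ x in Icc (0:ℝ) 1, |qm1 x - pm1 x| := by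
  have hint₁ : IntegrableOn (fun x => |q1 x - p1 x|) (Icc (0:ℝ) 1) := (hq1i.sub hp1i).abs
  have hint₂ : IntegrableOn (fun x => |qm1 x - pm1 x| / 2) (Icc (0:ℝ) 1) :=
    (hqm1i.sub hpm1i).abs.div_const 2
  have hle : (∫ x in Icc (0:ℝ) 1,
      |q1 x / (q1 x + qm1 x) - p1 x / (p1 x + pm1 x)| * ((p1 x + pm1 x)/2))
      ≤ ∫ x in Icc (0:ℝ) 1, (|q1 x - p1 x| + |qm1 x - pm1 x| / 2) := by
    refine integral_mono_of_nonneg (.of_forall fun x => ?_) (hint₁.add hint₂)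
      (.of_forall fun x => ?_)
    · exact mul_nonneg (abs_nonneg _) (half_pos (hppos x)).le
    · have h := abs_ratio_sub_ratio_mul_le (hq1 x) (hqm1 x) (hqpos x) (hppos x)
      change _ * _ ≤ |q1 x - p1 x| + |qm1 x - pm1 x| / 2
      linarith [abs_nonneg (q1 x - p1 x)]
  rw [integral_add hint₁ hint₂, integral_div] at hle
  linarith
end
end

section
/- Let n ≥ 1 be an integer, p_a, p_b ∈ [0,1], and r_a, r_b ∈ [0,1] with r := max{r_a, r_b} ≤ 1/2. Let N_a ~ Binomial(n, p_a) and N_b ~ Binomial(n, p_b) be independent, set N = N_a + N_b, and conditionally on (N_a, N_b) let Z = Z_a + Z_b where Z_a ~ Binomial(N_a, r_a) and Z_b ~ Binomial(N_b, r_b) are independent. Then P[Z > N/2] ≤ (1 − p_a·(1 − exp(−(1−2r)²/2)))^n · (1 − p_b·(1 − exp(−(1−2r)²/2)))^n. -/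
open MeasureTheory Set
open scoped ENNReal Classical

noncomputable section

lemma binomPMF_nonneg {m k : ℕ} {p : ℝ} (hp : p ∈ Icc (0:ℝ) 1) : 0 ≤ binomPMF m p k :=
  mul_nonneg (mul_nonneg (Nat.cast_nonneg _) (pow_nonneg hp.1 _))
    (pow_nonneg (sub_nonneg.2 hp.2) _)

/-- The bivariate generating function of the binomial distribution. -/
lemma sum_binomPMF_mul_pow (m : ℕ) (p x y : ℝ) :
    ∑ k ∈ Finset.range (m + 1), binomPMF m p k * (x ^ k * y ^ (m - k)) =
      (p * x + (1 - p) * y) ^ m := by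
  rw [add_pow]
  refine Finset.sum_congr rfl fun k _ => ?_
  simp only [binomPMF, mul_pow]
  ring

/-- A Chernoff-type bound: some exponential tilt `t ≥ 1` brings the moment generating function
of a biased sign below `exp (-(1 - 2r)² / 2)`. -/
lemma exists_tilt_le_exp {r : ℝ} (hr0 : 0 ≤ r) (hr : r ≤ 1 / 2) :
    ∃ t : ℝ, 1 ≤ t ∧ r * t + (1 - r) * t⁻¹ ≤ Real.exp (-(1 - 2 * r) ^ 2 / 2) := by
  rcases hr0.eq_or_lt with rfl | hpos
  · refine ⟨2, one_le_two, ?_⟩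
    have := Real.add_one_le_exp (-(1 - 2 * (0:ℝ)) ^ 2 / 2)
    norm_num at this ⊢
    linarith
  · set s := Real.sqrt (r * (1 - r)) with hs
    have hrr : 0 < r * (1 - r) := mul_pos hpos (by linarith)
    have hs_pos : 0 < s := Real.sqrt_pos.2 hrr
    have hs_sq : s ^ 2 = r * (1 - r) := Real.sq_sqrt hrr.le
    refine ⟨s / r, (one_le_div hpos).2 (Real.le_sqrt_of_sq_le (by nlinarith)), ?_⟩
    have hval : r * (s / r) + (1 - r) * (s / r)⁻¹ = 2 * s := by
      field_simp
      linarith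
    rw [hval]
    refine le_of_sq_le_sq ?_ (Real.exp_pos _).le
    rw [← Real.exp_nat_mul, mul_pow, hs_sq]
    have := Real.add_one_le_exp (-(1 - 2 * r) ^ 2)
    calc 2 ^ 2 * (r * (1 - r)) = -(1 - 2 * r) ^ 2 + 1 := by ring
      _ ≤ Real.exp (-(1 - 2 * r) ^ 2) := this
      _ = _ := by congr 1; push_cast; ring

/-- The indicator of a strict majority is dominated by an exponential tilt. -/
lemma majority_indicator_le {t : ℝ} (ht : 1 ≤ t) {na nb za zb : ℕ} (hza : za ≤ na)
    (hzb : zb ≤ nb) :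
    (if na + nb < 2 * (za + zb) then (1:ℝ) else 0) ≤
      (t ^ za * t⁻¹ ^ (na - za)) * (t ^ zb * t⁻¹ ^ (nb - zb)) := by
  have ht0 : 0 < t := one_pos.trans_le ht
  split_ifs with h
  · have hle : t ^ ((na - za) + (nb - zb)) ≤ t ^ (za + zb) :=
      pow_le_pow_right₀ ht (by omega)
    have heq : (t ^ za * t⁻¹ ^ (na - za)) * (t ^ zb * t⁻¹ ^ (nb - zb)) =
        t ^ (za + zb) / t ^ ((na - za) + (nb - zb)) := by
      rw [pow_add, pow_add, inv_pow, inv_pow]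
      field_simp
    rw [heq]
    exact (one_le_div (pow_pos ht0 _)).2 hle
  · positivity

/-- The tilted moment generating function of a binomial number of biased signs. -/
lemma binomial_mixture_le {t r r' p c : ℝ} (ht : 1 ≤ t) (hp : p ∈ Icc (0:ℝ) 1)
    (hr0 : r ∈ Icc (0:ℝ) 1) (hr : r ≤ r') (hc : r' * t + (1 - r') * t⁻¹ ≤ c) (n : ℕ) :
    ∑ m ∈ Finset.range (n + 1), binomPMF n p m *
        ∑ z ∈ Finset.range (m + 1), binomPMF m r z * (t ^ z * t⁻¹ ^ (m - z)) ≤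
      (1 - p * (1 - c)) ^ n := by
  have hinv : t⁻¹ ≤ t := (inv_le_one_of_one_le₀ ht).trans ht
  have hinv0 : 0 ≤ t⁻¹ := inv_nonneg.2 (zero_le_one.trans ht)
  have hq0 : 0 ≤ r * t + (1 - r) * t⁻¹ :=
    add_nonneg (mul_nonneg hr0.1 (zero_le_one.trans ht)) (mul_nonneg (sub_nonneg.2 hr0.2) hinv0)
  have hqc : r * t + (1 - r) * t⁻¹ ≤ c := by nlinarith
  have hmix : ∑ m ∈ Finset.range (n + 1), binomPMF n p m * (r * t + (1 - r) * t⁻¹) ^ m =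
      (p * (r * t + (1 - r) * t⁻¹) + (1 - p)) ^ n := by
    simpa using sum_binomPMF_mul_pow n p (r * t + (1 - r) * t⁻¹) 1
  simp only [sum_binomPMF_mul_pow]
  rw [hmix]
  refine pow_le_pow_left₀ (add_nonneg (mul_nonneg hp.1 hq0) (sub_nonneg.2 hp.2)) ?_ n
  linarith [mul_le_mul_of_nonneg_left hqc hp.1]

/-- **Lemma (majority-vote error bound with binomial bin counts).** Let `n ≥ 1`,
`p_a, p_b ∈ [0,1]`, `r_a, r_b ∈ [0,1]` with `r = max(r_a, r_b) ≤ 1/2`. Let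
`N_a ~ Bin(n, p_a)` and `N_b ~ Bin(n, p_b)` be independent, `N = N_a + N_b`, and
conditionally on `(N_a, N_b)` let `Z = Z_a + Z_b` with `Z_a ~ Bin(N_a, r_a)`,
`Z_b ~ Bin(N_b, r_b)` independent. Then
`P[Z > N/2] ≤ (1 - p_a(1 - e^{-(1-2r)²/2}))^n (1 - p_b(1 - e^{-(1-2r)²/2}))^n`.
The probability `P[Z > N/2]` is written out explicitly as a sum over the values of
`(N_a, N_b, Z_a, Z_b)` (note `Z > N/2 ↔ N < 2Z`). -/
theorem majority_vote_binomial_bound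
    (n : ℕ) (hn : 1 ≤ n) (pa pb ra rb : ℝ)
    (hpa : pa ∈ Icc (0:ℝ) 1) (hpb : pb ∈ Icc (0:ℝ) 1)
    (hra : ra ∈ Icc (0:ℝ) 1) (hrb : rb ∈ Icc (0:ℝ) 1)
    (hr : max ra rb ≤ 1/2) :
    (∑ na ∈ Finset.range (n+1), ∑ nb ∈ Finset.range (n+1),
      ∑ za ∈ Finset.range (na+1), ∑ zb ∈ Finset.range (nb+1),
        binomPMF n pa na * binomPMF n pb nb * binomPMF na ra za * binomPMF nb rb zb *
          (if na + nb < 2*(za + zb) then 1 else 0))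
      ≤ (1 - pa*(1 - Real.exp (-(1-2*max ra rb)^2/2)))^n *
        (1 - pb*(1 - Real.exp (-(1-2*max ra rb)^2/2)))^n := by
  obtain ⟨t, ht, htc⟩ := exists_tilt_le_exp (le_max_of_le_left hra.1) hr
  have ha := binomial_mixture_le ht hpa hra (le_max_left ra rb) htc n
  have hb := binomial_mixture_le ht hpb hrb (le_max_right ra rb) htc n
  have ht0 : 0 < t := one_pos.trans_le ht
  have mixture_nonneg : ∀ {p r : ℝ}, p ∈ Icc (0:ℝ) 1 → r ∈ Icc (0:ℝ) 1 →
      0 ≤ ∑ m ∈ Finset.range (n + 1), binomPMF n p m *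
        ∑ z ∈ Finset.range (m + 1), binomPMF m r z * (t ^ z * t⁻¹ ^ (m - z)) :=
    fun hp hr => Finset.sum_nonneg fun m _ => mul_nonneg (binomPMF_nonneg hp) <|
      Finset.sum_nonneg fun z _ => mul_nonneg (binomPMF_nonneg hr) (by positivity)
  refine le_trans ?_ (mul_le_mul ha hb (mixture_nonneg hpb hrb)
    ((mixture_nonneg hpa hra).trans ha))
  rw [Finset.sum_mul_sum]
  refine Finset.sum_le_sum fun na _ => Finset.sum_le_sum fun nb _ => ?_
  rw [mul_mul_mul_comm, Finset.sum_mul_sum, Finset.mul_sum]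
  refine Finset.sum_le_sum fun za hza => ?_
  rw [Finset.mul_sum]
  refine Finset.sum_le_sum fun zb hzb => ?_
  have hw : 0 ≤ binomPMF n pa na * binomPMF n pb nb * binomPMF na ra za * binomPMF nb rb zb :=
    mul_nonneg (mul_nonneg (mul_nonneg (binomPMF_nonneg hpa) (binomPMF_nonneg hpb))
      (binomPMF_nonneg hra)) (binomPMF_nonneg hrb)
  refine (mul_le_mul_of_nonneg_left (majority_indicator_le ht
    (Finset.mem_range_succ_iff.1 hza) (Finset.mem_range_succ_iff.1 hzb)) hw).trans_eq ?_
  ring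
end
end
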